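/- Let (K,v) be a valued field and F/Kv any field extension of its residue field. Then there exists an extension of valued fields (L,w)/(K,v) such that the residue field extension Lw/Kv is isomorphic to F/Kv. -/

import Mathlib

universe u v

open Polynomial IsLocalRing

/-- The residue map sees units. -/
lemma vfe_residue_ne_zero {Ω : Type u} [Field Ω] (W : ValuationSubring Ω) (x : W)
    (hx : residue W x ≠ 0) : (x : Ω)⁻¹ ∈ W := by
  have hu : IsUnit x := by
    by_contra h
    exact hx ((residue_eq_zero_iff x).2 ((mem_maximalIdeal x).2 h))
  obtain ⟨y, hy⟩ := hu.exists_right_inv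
  have h1 : (x : Ω) * y = 1 := by exact_mod_cast congrArg Subtype.val hy
  rw [inv_eq_of_mul_eq_one_right h1]
  exact y.2

/-- Normalising a polynomial so that it is integral with nonzero reduction. -/
lemma vfe_normalize {M : Type u} [Field M] (A : ValuationSubring M) (p : M[X]) (hp : p ≠ 0) :
    ∃ (c : M) (q : A[X]), c ≠ 0 ∧ p = C c * q.map A.subtype ∧ q.map (residue A) ≠ 0 := by
  obtain ⟨i, hi, hmax⟩ := Finset.exists_max_image p.support (fun i => A.valuation (p.coeff i))
    (Polynomial.support_nonempty.2 hp)
  have hi0 : p.coeff i ≠ 0 := Polynomial.mem_support_iff.1 hi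
  have hl : C (p.coeff i)⁻¹ * p ∈ lifts A.subtype := by
    rw [lifts_iff_coeff_lifts]
    intro n
    have : (p.coeff i)⁻¹ * p.coeff n ∈ A := by
      by_cases hn : p.coeff n = 0
      · simp [hn]
      · rw [← A.valuation_le_one_iff, map_mul, map_inv₀]
        have h0 : A.valuation (p.coeff i) ≠ 0 := by simpa using hi0
        have := hmax n (Polynomial.mem_support_iff.2 hn)
        rw [inv_mul_le_iff₀ (zero_lt_iff.2 h0)]
        simpa using this
    exact ⟨⟨_, this⟩, by simp⟩
  obtain ⟨q, hq⟩ := (mem_lifts _).1 hl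
  refine ⟨p.coeff i, q, hi0, ?_, ?_⟩
  · rw [hq, ← mul_assoc, ← C_mul, mul_inv_cancel₀ hi0]; simp
  · intro h
    have h1 : q.coeff i = 1 := by
      have := congrArg (fun r => r.coeff i) hq
      simp only [coeff_map, coeff_C_mul] at this
      rw [inv_mul_cancel₀ hi0] at this
      exact Subtype.ext this
    have := congrArg (fun r => r.coeff i) h
    simp [h1] at this

/-- The set-up: a subfield `M` whose residues lie in `F`. -/
def VfeGood {Ω : Type u} [Field Ω] (W : ValuationSubring Ω) (F' : Subfield (ResidueField W))
    (M : Subfield Ω) : Prop :=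
  ∀ (x : Ω) (hx : x ∈ W), x ∈ M → residue W ⟨x, hx⟩ ∈ F'

/-- The inclusion of the induced valuation ring. -/
def vfeIncl {Ω : Type u} [Field Ω] (W : ValuationSubring Ω) (M : Subfield Ω) :
    (W.comap M.subtype) →+* W where
  toFun x := ⟨M.subtype x.1, x.2⟩
  map_one' := rfl
  map_zero' := rfl
  map_add' _ _ := rfl
  map_mul' _ _ := rfl

instance vfeIncl_local {Ω : Type u} [Field Ω] (W : ValuationSubring Ω) (M : Subfield Ω) :
    IsLocalHom (vfeIncl W M) := by
  constructor
  intro a ha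
  obtain ⟨y, hy⟩ := ha.exists_right_inv
  have h1 : ((a : M) : Ω) * y = 1 := congrArg Subtype.val hy
  have h2 : ((a : M)⁻¹ : M) ∈ W.comap M.subtype := by
    rw [ValuationSubring.mem_comap, map_inv₀]
    have : (M.subtype a.1)⁻¹ = (y : Ω) := inv_eq_of_mul_eq_one_right h1
    rw [this]; exact y.2
  refine IsUnit.of_mul_eq_one ⟨_, h2⟩ ?_
  apply Subtype.ext
  have : (a : M) ≠ 0 := by
    intro h; rw [h] at h1; simp at h1
  exact mul_inv_cancel₀ this

/-- Adjoining a suitable lift keeps the residue field inside `F`. -/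
lemma vfe_adjoin {Ω : Type u} [Field Ω] (W : ValuationSubring Ω)
    (F' : Subfield (ResidueField W)) (M : Subfield Ω) (hM : VfeGood W F' M)
    (b : W) (hb : residue W b ∈ F')
    (key : ∀ p : M[X], aeval (b : Ω) p ≠ 0 → ∃ (c : M) (q : (W.comap M.subtype)[X]),
      aeval (b : Ω) p = c * ((q.eval₂ (vfeIncl W M) b : W) : Ω) ∧
      residue W (q.eval₂ (vfeIncl W M) b) ≠ 0) :
    ∃ M' : Subfield Ω, M ≤ M' ∧ (b : Ω) ∈ M' ∧ VfeGood W F' M' := by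
  have hq : ∀ q : (W.comap M.subtype)[X], residue W (q.eval₂ (vfeIncl W M) b) ∈ F' := by
    intro q
    rw [eval₂_eq_sum_range, map_sum]
    refine sum_mem fun i _ => ?_
    rw [map_mul, map_pow]
    exact mul_mem (hM _ _ (q.coeff i).1.2) (pow_mem hb i)
  refine ⟨(IntermediateField.adjoin M {(b : Ω)}).toSubfield, ?_, ?_, ?_⟩
  · intro x hx
    exact (IntermediateField.adjoin M {(b : Ω)}).algebraMap_mem ⟨x, hx⟩
  · exact IntermediateField.mem_adjoin_simple_self M (b : Ω)
  · intro x hxW hx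
    obtain ⟨r, s, rfl⟩ := (IntermediateField.mem_adjoin_simple_iff M x).1 hx
    by_cases hr : aeval (b : Ω) r = 0
    · have : (⟨_, hxW⟩ : W) = 0 := Subtype.ext (by simp [hr])
      rw [this, map_zero]; exact zero_mem _
    by_cases hs : aeval (b : Ω) s = 0
    · have : (⟨_, hxW⟩ : W) = 0 := Subtype.ext (by simp [hs])
      rw [this, map_zero]; exact zero_mem _
    obtain ⟨c, q, h1, h2⟩ := key r hr
    obtain ⟨d, t, h3, h4⟩ := key s hs
    have hqi := vfe_residue_ne_zero W _ h2
    have hti := vfe_residue_ne_zero W _ h4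
    have hmq := hq q
    have hmt := hq t
    generalize eval₂ (vfeIncl W M) b q = y at *
    generalize eval₂ (vfeIncl W M) b t = z at *
    have hy0 : (y : Ω) ≠ 0 := by rintro h; rw [h] at h1; simp at h1; exact hr h1
    have hz0 : (z : Ω) ≠ 0 := by rintro h; rw [h] at h3; simp at h3; exact hs h3
    have hd0 : (d : Ω) ≠ 0 := by rintro h; rw [h] at h3; simp at h3; exact hs h3
    have hcd : (c : Ω) / d ∈ W := by
      have : (c : Ω) / d = (aeval (b : Ω) r / aeval (b : Ω) s) * z * (y : Ω)⁻¹ := by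
        rw [h1, h3]; field_simp
      rw [this]; exact mul_mem (mul_mem hxW z.2) hqi
    have hcdF := hM _ hcd (div_mem c.2 d.2)
    have hprod : (⟨_, hxW⟩ : W) * z = ⟨_, hcd⟩ * y := by
      apply Subtype.ext
      change aeval (b : Ω) r / aeval (b : Ω) s * z = (c : Ω) / d * y
      rw [h1, h3]; field_simp
    have := congrArg (residue W) hprod
    rw [map_mul, map_mul] at this
    rw [eq_div_of_mul_eq h4 this]
    exact div_mem (mul_mem hcdF hmq) hmt

/-- Extension step. -/
lemma vfe_step {Ω : Type u} [Field Ω] [IsAlgClosed Ω] (W : ValuationSubring Ω)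
    (F' : Subfield (ResidueField W)) (M : Subfield Ω) (hM : VfeGood W F' M)
    (a : ResidueField W) (ha : a ∈ F') :
    ∃ M' : Subfield Ω, M ≤ M' ∧ VfeGood W F' M' ∧ ∃ b : W, (b : Ω) ∈ M' ∧ residue W b = a := by
  let A := W.comap M.subtype
  let ψ : ResidueField A →+* ResidueField W := ResidueField.map (vfeIncl W M)
  let _ : Algebra (ResidueField A) (ResidueField W) := ψ.toAlgebra
  have hψ : ∀ (q : A[X]) (b : W), residue W (q.eval₂ (vfeIncl W M) b) =
      aeval (residue W b) (q.map (residue A)) := by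
    intro q b
    rw [hom_eval₂, aeval_def, eval₂_map]
    rfl
  have hev : ∀ (c : M) (q : A[X]) (b : W), aeval (b : Ω) (C c * q.map A.subtype) =
      c * ((q.eval₂ (vfeIncl W M) b : W) : Ω) := by
    intro c q b
    rw [map_mul, aeval_C, aeval_def, eval₂_map]
    congr 1
    exact (hom_eval₂ q (vfeIncl W M) W.subtype b).symm
  suffices h : ∃ b : W, residue W b = a ∧ ∀ p : M[X], aeval (b : Ω) p ≠ 0 →
      ∃ p' : M[X], p' ≠ 0 ∧ aeval (b : Ω) p = aeval (b : Ω) p' ∧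
        ∀ g : (ResidueField A)[X], g ≠ 0 → g.degree ≤ p'.degree → aeval a g ≠ 0 by
    obtain ⟨b, rfl, h⟩ := h
    obtain ⟨M', h1, h2, h3⟩ := vfe_adjoin W F' M hM b ha (by
      intro p hp
      obtain ⟨p', hp', h1, h2⟩ := h p hp
      obtain ⟨c, q, hc, h3, h4⟩ := vfe_normalize A p' hp'
      refine ⟨c, q, ?_, ?_⟩
      · rw [h1, h3]; exact hev c q b
      · rw [hψ]
        refine h2 _ h4 ?_
        rw [h3, degree_C_mul hc, degree_map_eq_of_injective A.subtype_injective]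
        exact degree_map_le)
    exact ⟨M', h1, h3, b, h2, rfl⟩
  by_cases hal : IsIntegral (ResidueField A) a
  · have hmon := minpoly.monic hal
    obtain ⟨f, hf1, hf2, hf3⟩ := lifts_and_degree_eq_and_monic (f := residue A)
      (p := minpoly (ResidueField A) a) (by
        obtain ⟨q, hq⟩ := map_surjective _ (residue_surjective (R := A)) (minpoly (ResidueField A) a)
        exact (mem_lifts _).2 ⟨q, hq⟩) hmon
    -- a root of `f` reducing to `a`
    let fΩ : Polynomial Ω := (f.map (vfeIncl W M)).map W.subtype
    have hfm : (f.map (vfeIncl W M)).Monic := hf3.map _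
    obtain ⟨b, hb1, hb2⟩ : ∃ b : W, residue W b = a ∧ eval₂ (vfeIncl W M) b f = 0 := by
      have hint : ∀ x ∈ fΩ.roots, x ∈ W := by
        intro x hx
        have hx0 := (mem_roots'.1 hx).2
        have : IsIntegral W x := ⟨f.map (vfeIncl W M), hfm, by
          rw [IsRoot.def, eval_map] at hx0; exact hx0⟩
        obtain ⟨y, hy⟩ := IsIntegrallyClosed.isIntegral_iff.1 this
        rw [← hy]; exact y.2
      have hsp : fΩ = (fΩ.roots.map (fun x => X - C x)).prod :=
        (IsAlgClosed.splits fΩ).eq_prod_roots_of_monic (hfm.map _)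
      let s : Multiset W := fΩ.roots.pmap (fun x hx => (⟨x, hx⟩ : W)) hint
      have hs : s.map W.subtype = fΩ.roots := by
        simp only [s, Multiset.map_pmap]
        exact (Multiset.pmap_eq_map _ _ _ _).trans (Multiset.map_id _)
      have hfW : f.map (vfeIncl W M) = (s.map (fun x => X - C x)).prod := by
        apply map_injective W.subtype W.subtype_injective
        rw [Polynomial.map_multiset_prod, Multiset.map_map]
        change fΩ = _
        rw [hsp, ← hs, Multiset.map_map]
        simp
      obtain ⟨b0, hb0⟩ := residue_surjective a
      have hz : residue W ((f.map (vfeIncl W M)).eval b0) = 0 := by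
        rw [eval_map, hψ, hb0, hf1, minpoly.aeval]
      rw [hfW, eval_multiset_prod, Multiset.map_map, map_multiset_prod, Multiset.map_map,
        Multiset.prod_eq_zero_iff] at hz
      obtain ⟨b, hbs, hb⟩ := Multiset.mem_map.1 hz
      simp only [Function.comp_apply, eval_sub, eval_X, eval_C, map_sub] at hb
      refine ⟨b, ?_, ?_⟩
      · rw [← hb0]; exact (sub_eq_zero.1 hb).symm
      · rw [← eval_map, hfW, eval_multiset_prod, Multiset.map_map]
        apply Multiset.prod_eq_zero
        exact Multiset.mem_map.2 ⟨b, hbs, by simp⟩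
    refine ⟨b, hb1, fun p hp => ?_⟩
    have hfM : (f.map A.subtype).Monic := hf3.map _
    have hroot : aeval (b : Ω) (f.map A.subtype) = 0 := by
      have := hev 1 f b
      rw [hb2] at this
      simpa using this
    have heq : aeval (b : Ω) p = aeval (b : Ω) (p %ₘ f.map A.subtype) :=
      (aeval_modByMonic_eq_self_of_root hroot).symm
    refine ⟨p %ₘ f.map A.subtype, ?_, heq, ?_⟩
    · intro h; rw [h, map_zero] at heq; exact hp heq
    · intro g hg hdeg h0
      have h1 := minpoly.degree_le_of_ne_zero (ResidueField A) a hg h0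
      have h2 := degree_modByMonic_lt p hfM
      rw [degree_map_eq_of_injective A.subtype_injective, hf2] at h2
      exact absurd (h1.trans hdeg) (not_le.2 h2)
  · obtain ⟨b, hb⟩ := residue_surjective a
    refine ⟨b, hb, fun p hp => ⟨p, ?_, rfl, ?_⟩⟩
    · rintro rfl; simp at hp
    · intro g hg _ h0
      exact hal (isAlgebraic_iff_isIntegral.1 ⟨g, hg, h0⟩)

/-- A maximal good subfield has residue field exactly `F`. -/
lemma vfe_max {Ω : Type u} [Field Ω] [IsAlgClosed Ω] (W : ValuationSubring Ω)
    (F' : Subfield (ResidueField W)) (M₀ : Subfield Ω) (hM₀ : VfeGood W F' M₀) :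
    ∃ M : Subfield Ω, M₀ ≤ M ∧ VfeGood W F' M ∧
      ∀ a ∈ F', ∃ b : W, (b : Ω) ∈ M ∧ residue W b = a := by
  obtain ⟨M, h1, h2⟩ := zorn_le_nonempty₀ {M | VfeGood W F' M} (by
    intro c hc hch y hy
    refine ⟨sSup c, ?_, fun z hz => le_sSup hz⟩
    intro x hxW hx
    obtain ⟨N, hN, hxN⟩ := (Subfield.mem_sSup_of_directedOn ⟨y, hy⟩ hch.directedOn).1 hx
    exact hc hN x hxW hxN) M₀ hM₀
  refine ⟨M, h1, h2.1, fun a ha => ?_⟩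
  obtain ⟨M', h3, h4, b, hb, hba⟩ := vfe_step W F' M h2.1 a ha
  exact ⟨b, h2.2 h4 h3 hb, hba⟩

/-- A large algebraically closed valued field whose residue field contains `F`. -/
lemma vfe_big (K : Type u) [Field K] (O : ValuationSubring K)
    (F : Type v) [Field F] [Algebra (ResidueField O) F] :
    ∃ (Ω : Type (max u v)) (_ : Field Ω) (_ : IsAlgClosed Ω) (W : ValuationSubring Ω)
      (f : K →+* Ω) (h : ∀ x : K, x ∈ O ↔ f x ∈ W) (ι : F →+* ResidueField W),
      ∀ x : O, residue W ⟨f x, (h x).1 x.2⟩ =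
        ι (algebraMap (ResidueField O) F (residue O x)) := by
  let R := MvPolynomial F O
  let ρ : O →+* F := (algebraMap (ResidueField O) F).comp (residue O)
  let π : R →+* F := MvPolynomial.eval₂Hom ρ id
  have hπ : Function.Surjective π := fun a => ⟨MvPolynomial.X a, MvPolynomial.eval₂_X ρ id a⟩
  let P : Ideal R := RingHom.ker π
  have : P.IsPrime := RingHom.ker_isPrime π
  let Ω := AlgebraicClosure (FractionRing R)
  let j : R →+* Ω := (algebraMap (FractionRing R) Ω).comp (algebraMap R (FractionRing R))
  have hj : Function.Injective j :=
    (algebraMap (FractionRing R) Ω).injective.comp (IsFractionRing.injective R _)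
  let e : Localization.AtPrime P →+* Ω := IsLocalization.lift (M := P.primeCompl) (g := j) (by
    intro y
    refine isUnit_iff_ne_zero.2 ?_
    intro h
    have : (y : R) = 0 := hj (by rw [h, map_zero])
    exact y.2 (by rw [this]; exact zero_mem _))
  have hej : ∀ x : R, e (algebraMap R _ x) = j x := fun x => IsLocalization.lift_eq _ x
  obtain ⟨W, hW, hloc⟩ := IsLocalRing.exists_factor_valuationRing (R := Localization.AtPrime P) (K := Ω) e
  have hjW : ∀ x, j x ∈ W := fun x => by rw [← hej]; exact hW _
  let θ : R →+* W := j.codRestrict W.toSubring hjW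
  have hθ : ∀ x ∈ P, residue W (θ x) = 0 := by
    intro x hx
    rw [residue_eq_zero_iff, mem_maximalIdeal, mem_nonunits_iff]
    intro hu
    have : (θ x) = (e.codRestrict W.toSubring hW) (algebraMap R _ x) :=
      Subtype.ext (hej x).symm
    rw [this] at hu
    have hu2 := hloc.map_nonunit _ hu
    exact (IsLocalization.AtPrime.isUnit_to_map_iff _ P x).1 hu2 hx
  let ι : F →+* ResidueField W := π.liftOfSurjective hπ ⟨(residue W).comp θ, fun x hx => hθ x hx⟩
  have hι : ∀ x, ι (π x) = residue W (θ x) := fun x =>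
    π.liftOfRightInverse_comp_apply _ _ ⟨(residue W).comp θ, fun x hx => hθ x hx⟩ x
  have hOinj : Function.Injective (j.comp (MvPolynomial.C (σ := F))) :=
    hj.comp (MvPolynomial.C_injective F O)
  let f : K →+* Ω := IsFractionRing.lift (A := O) hOinj
  have hf : ∀ x : O, f x = j (MvPolynomial.C x) := fun x =>
    IsFractionRing.lift_algebraMap hOinj x
  have hπC : ∀ x : O, π (MvPolynomial.C x) = ρ x := fun x => MvPolynomial.eval₂_C ρ id x
  have h1 : ∀ x : K, x ∈ O → f x ∈ W := fun x hx => by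
    rw [hf ⟨x, hx⟩]; exact hjW _
  have h2 : ∀ x : K, f x ∈ W → x ∈ O := by
    intro x hx
    by_contra hxO
    have hxi : x⁻¹ ∈ O := (O.mem_or_inv_mem x).resolve_left hxO
    have hx0 : x ≠ 0 := by rintro rfl; exact hxO O.zero_mem
    have hr : residue O ⟨x⁻¹, hxi⟩ = 0 := by
      by_contra hne
      have := vfe_residue_ne_zero O _ hne
      simp at this
      exact hxO this
    have h3 : residue W (θ (MvPolynomial.C ⟨x⁻¹, hxi⟩)) = 0 := by
      rw [← hι, hπC]; simp [ρ, hr]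
    have h4 : θ (MvPolynomial.C ⟨x⁻¹, hxi⟩) * ⟨f x, hx⟩ = 1 := by
      apply Subtype.ext
      change j (MvPolynomial.C ⟨x⁻¹, hxi⟩) * f x = 1
      rw [← hf, ← map_mul]
      simp [hx0]
    have h5 := congrArg (residue W) h4
    rw [map_mul, h3] at h5
    simp at h5
  refine ⟨Ω, inferInstance, inferInstance, W, f, fun x => ⟨h1 x, h2 x⟩, ι, fun x => ?_⟩
  have : (⟨f x, h1 x x.2⟩ : W) = θ (MvPolynomial.C x) := Subtype.ext (hf x)
  rw [this, ← hι, hπC]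
  rfl

/-- Given a valued field `(K, O)` and a field extension `F` of its residue field, there is an
extension of valued fields `(L, O')/(K, O)` whose residue field extension is isomorphic to
`F/Kv`. -/
theorem exists_valued_field_extension_with_residue_extension
    (K : Type u) [Field K] (O : ValuationSubring K)
    (F : Type v) [Field F] [Algebra (IsLocalRing.ResidueField ↥O) F] :
    ∃ (L : Type (max u v)) (_ : Field L) (O' : ValuationSubring L) (f : K →+* L)
      (h : ∀ x : K, x ∈ O ↔ f x ∈ O')
      (g : IsLocalRing.ResidueField ↥O' ≃+* F),
      ∀ x : ↥O,
        g (IsLocalRing.residue ↥O' ⟨f x, (h x).1 x.2⟩) =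
          algebraMap (IsLocalRing.ResidueField ↥O) F (IsLocalRing.residue ↥O x) := by

  obtain ⟨Ω, _, _, W, f, h, ι, hι⟩ := vfe_big K O F
  obtain ⟨M, hM1, hM2, hM3⟩ := vfe_max W ι.fieldRange f.fieldRange (by
    rintro _ hxW ⟨x, rfl⟩
    exact ⟨_, (hι ⟨x, (h x).2 hxW⟩).symm⟩)
  let A := W.comap M.subtype
  let ψ : ResidueField A →+* ResidueField W := ResidueField.map (vfeIncl W M)
  have hψ : ∀ x, ψ x ∈ ι.fieldRange := by
    intro x
    obtain ⟨x, rfl⟩ := residue_surjective x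
    exact hM2 _ x.2 x.1.2
  have hψ' : ∀ y : F, ∃ x, ψ x = ι y := by
    intro y
    obtain ⟨b, hb, hby⟩ := hM3 (ι y) ⟨y, rfl⟩
    exact ⟨residue A ⟨⟨b, hb⟩, b.2⟩, hby⟩
  choose g hg using hψ
  choose g' hg' using hψ'
  let G : ResidueField A ≃+* F :=
    { toFun := g
      invFun := g'
      left_inv := fun x => ψ.injective (by rw [hg', hg])
      right_inv := fun y => ι.injective (by rw [hg, hg'])
      map_mul' := fun x y => ι.injective (by simp only [map_mul, hg])
      map_add' := fun x y => ι.injective (by simp only [map_add, hg]) }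
  refine ⟨M, inferInstance, A, f.codRestrict M (fun x => hM1 ⟨x, rfl⟩), fun x => h x, G, ?_⟩
  intro x
  apply ι.injective
  rw [← hι x]
  exact hg _
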